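/- arXiv:1606.03244 — 8 statements merged into one kernel-verified Lean document; each statement's English description precedes it below -/
import Mathlib

section
/- If G is a connected undirected graph on n agents with n ≥ 2, then for every d ≥ 1 there exists a call sequence on G of length at most d(2n−3) whose final state contains every fluent of length between 2 and d+1 (so it establishes all positive epistemic goals of depth at most d). -/
/-- A fluent is a nonempty list of agents `(i_1, ..., i_r, j)` representing
`K_{i_1} ... K_{i_r} s_j`.  In the initial state a fluent is true iff `r = 0` or `i_r = j`. -/
def initState (n : ℕ) : Set (List (Fin n)) :=
  {l | (∃ j, l = [j]) ∨ ∃ p j, l = p ++ [j, j]}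

/-- A two-way call between agents `i` and `j`. -/
def callStep {n : ℕ} (i j : Fin n) (S : Set (List (Fin n))) : Set (List (Fin n)) :=
  S ∪ {l | ∃ w f : List (Fin n), l = w ++ f ∧ w ≠ [] ∧ (∀ a ∈ w, a = i ∨ a = j) ∧
        f ≠ [] ∧ (i :: f ∈ S ∨ j :: f ∈ S)}

/-- The state resulting from applying a sequence of two-way calls to the initial state. -/
def runCalls (n : ℕ) (calls : List (Fin n × Fin n)) : Set (List (Fin n)) :=
  calls.foldl (fun S c => callStep c.1 c.2 S) (initState n)

/-- The state resulting from applying a sequence of two-way calls to the state `S`. -/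
def runFrom {n : ℕ} (calls : List (Fin n × Fin n)) (S : Set (List (Fin n))) :
    Set (List (Fin n)) :=
  calls.foldl (fun S c => callStep c.1 c.2 S) S

lemma subset_runFrom {n : ℕ} (calls : List (Fin n × Fin n)) (S : Set (List (Fin n))) :
    S ⊆ runFrom calls S := by
  induction calls generalizing S with
  | nil => exact subset_rfl
  | cons c t ih => exact Set.subset_union_left.trans (ih (callStep c.1 c.2 S))

lemma runFrom_append {n : ℕ} (c₁ c₂ : List (Fin n × Fin n)) (S : Set (List (Fin n))) :
    runFrom (c₁ ++ c₂) S = runFrom c₂ (runFrom c₁ S) :=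
  List.foldl_append

/-- After a call, both participants know everything that either of them knew before. -/
lemma cons_mem_callStep {n : ℕ} {i j a : Fin n} {S : Set (List (Fin n))} {f : List (Fin n)}
    (hf : f ≠ []) (h : i :: f ∈ S ∨ j :: f ∈ S) (ha : a = i ∨ a = j) :
    a :: f ∈ callStep i j S :=
  Or.inr ⟨[a], f, rfl, by simp, by simpa using ha, hf, h⟩

/-- Positive introspection: agents know what they know. -/
def Introspective {n : ℕ} (S : Set (List (Fin n))) : Prop :=
  ∀ b g, b :: g ∈ S → b :: b :: g ∈ S

lemma introspective_initState (n : ℕ) : Introspective (initState n) := by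
  rintro b g (⟨j, hj⟩ | ⟨p, j, hp⟩)
  · obtain ⟨rfl, rfl⟩ := List.cons.inj hj
    exact Or.inr ⟨[], b, rfl⟩
  · exact Or.inr ⟨b :: p, j, by rw [hp]; rfl⟩

lemma Introspective.callStep {n : ℕ} {S : Set (List (Fin n))} (hS : Introspective S)
    (i j : Fin n) : Introspective (callStep i j S) := by
  rintro b g (h | ⟨w, f, hl, hw, hwm, hf, h⟩)
  · exact Or.inl (hS b g h)
  · obtain ⟨c, w, rfl⟩ := List.exists_cons_of_ne_nil hw
    obtain ⟨rfl, rfl⟩ := List.cons.inj hl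
    exact Or.inr ⟨b :: b :: w, f, rfl, by simp, by simpa using hwm, hf, h⟩

lemma Introspective.runFrom {n : ℕ} {S : Set (List (Fin n))} (hS : Introspective S)
    (calls : List (Fin n × Fin n)) : Introspective (runFrom calls S) := by
  induction calls generalizing S with
  | nil => exact hS
  | cons c t ih => exact ih (hS.callStep c.1 c.2)

/-- The calls spread the knowledge of any member of `C` to all members of `C`. -/
def Spreads {n : ℕ} (C : Finset (Fin n)) (calls : List (Fin n × Fin n)) : Prop :=
  ∀ S : Set (List (Fin n)), ∀ f ≠ [], ∀ b ∈ C, b :: f ∈ S → ∀ a ∈ C, a :: f ∈ runFrom calls S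

lemma spreads_pair {n : ℕ} (u v : Fin n) : Spreads {u, v} [(u, v)] := by
  intro S f hf b hb hS a ha
  simp only [Finset.mem_insert, Finset.mem_singleton] at hb ha
  refine cons_mem_callStep hf ?_ ha
  rcases hb with rfl | rfl
  · exact Or.inl hS
  · exact Or.inr hS

lemma Spreads.insert {n : ℕ} {C : Finset (Fin n)} {calls : List (Fin n × Fin n)}
    (h : Spreads C calls) {x : Fin n} (hx : x ∈ C) (y : Fin n) :
    Spreads (insert y C) ((x, y) :: (calls ++ [(x, y)])) := by
  intro S f hf b hb hS a ha
  change a :: f ∈ runFrom (calls ++ [(x, y)]) (callStep x y S)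
  rw [runFrom_append]
  have key : ∀ c ∈ C, c :: f ∈ runFrom calls (callStep x y S) := by
    rcases Finset.mem_insert.1 hb with rfl | hb
    · exact h _ f hf x hx (cons_mem_callStep hf (Or.inr hS) (Or.inl rfl))
    · exact h _ f hf b hb (Or.inl hS)
  rcases Finset.mem_insert.1 ha with rfl | ha
  · exact cons_mem_callStep hf (Or.inl (key x hx)) (Or.inr rfl)
  · exact Or.inl (key a ha)

lemma SimpleGraph.Connected.exists_adj_boundary {V : Type*} {G : SimpleGraph V}
    (hG : G.Connected) {C : Set V} {u v : V} (hu : u ∈ C) (hv : v ∉ C) :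
    ∃ x ∈ C, ∃ y ∉ C, G.Adj x y := by
  obtain ⟨p⟩ := hG.preconnected u v
  obtain ⟨e, -, h₁, h₂⟩ := p.exists_boundary_dart C hu hv
  exact ⟨e.fst, h₁, e.snd, h₂, e.adj⟩

lemma exists_spreads_of_card {n : ℕ} (hn : 2 ≤ n) {G : SimpleGraph (Fin n)}
    (hG : G.Connected) (m : ℕ) (hm : m + 2 ≤ n) :
    ∃ (C : Finset (Fin n)) (calls : List (Fin n × Fin n)), C.card = m + 2 ∧
      (∀ c ∈ calls, G.Adj c.1 c.2) ∧ calls.length = 2 * m + 1 ∧ Spreads C calls := by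
  induction m with
  | zero =>
    obtain ⟨x, -, y, -, hxy⟩ := hG.exists_adj_boundary (C := {(⟨0, by omega⟩ : Fin n)})
      (v := ⟨1, by omega⟩) rfl (by simp)
    exact ⟨{x, y}, [(x, y)], Finset.card_pair hxy.ne, by simpa using hxy, rfl,
      spreads_pair x y⟩
  | succ m ih =>
    obtain ⟨C, calls, hC, hadj, hlen, hs⟩ := ih (by omega)
    obtain ⟨u, hu⟩ : C.Nonempty := Finset.card_pos.1 (by omega)
    obtain ⟨v, hv⟩ : ∃ v, v ∉ C := by
      by_contra! hall
      rw [Finset.eq_univ_iff_forall.2 hall, Finset.card_univ, Fintype.card_fin] at hC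
      omega
    obtain ⟨x, hx, y, hy, hxy⟩ := hG.exists_adj_boundary (C := (C : Set (Fin n))) hu hv
    refine ⟨insert y C, _, ?_, ?_, ?_, hs.insert hx y⟩
    · rw [Finset.card_insert_of_notMem hy, hC]
    · intro c hc
      simp only [List.mem_cons, List.mem_append, List.not_mem_nil, or_false] at hc
      rcases hc with rfl | hc | rfl
      exacts [hxy, hadj c hc, hxy]
    · simp only [List.length_cons, List.length_append, List.length_nil, hlen]
      omega

lemma exists_spreads_univ {n : ℕ} (hn : 2 ≤ n) {G : SimpleGraph (Fin n)}
    (hG : G.Connected) :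
    ∃ calls : List (Fin n × Fin n), (∀ c ∈ calls, G.Adj c.1 c.2) ∧
      calls.length = 2 * n - 3 ∧ Spreads Finset.univ calls := by
  obtain ⟨C, calls, hC, hadj, hlen, hs⟩ := exists_spreads_of_card hn hG (n - 2) (by omega)
  obtain rfl : C = Finset.univ := by
    rw [← Finset.card_eq_iff_eq_univ, Fintype.card_fin]
    omega
  exact ⟨calls, hadj, by omega, hs⟩

lemma exists_calls_of_depth {n : ℕ} (hn : 2 ≤ n) {G : SimpleGraph (Fin n)}
    (hG : G.Connected) (d : ℕ) :
    ∃ calls : List (Fin n × Fin n), (∀ c ∈ calls, G.Adj c.1 c.2) ∧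
      calls.length = d * (2 * n - 3) ∧
      ∀ l : List (Fin n), 1 ≤ l.length → l.length ≤ d + 1 →
        l ∈ runFrom calls (initState n) := by
  induction d with
  | zero =>
    refine ⟨[], by simp, by simp, fun l h₁ h₂ => Or.inl ?_⟩
    exact List.length_eq_one_iff.1 (by omega)
  | succ d ih =>
    obtain ⟨calls, hadj, hlen, hmem⟩ := ih
    obtain ⟨round, hradj, hrlen, hs⟩ := exists_spreads_univ hn hG
    refine ⟨calls ++ round, ?_, ?_, fun l h₁ h₂ => ?_⟩
    · intro c hc
      exact (List.mem_append.1 hc).elim (hadj c) (hradj c)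
    · rw [List.length_append, hlen, hrlen]
      ring
    · rw [runFrom_append]
      by_cases hl : l.length ≤ d + 1
      · exact subset_runFrom _ _ (hmem l h₁ hl)
      · match l with
        | [] => simp at h₁
        | [a] => simp at hl
        | a :: b :: g =>
          have hb : b :: g ∈ runFrom calls (initState n) :=
            hmem _ (by simp) (by simpa using h₂)
          exact hs _ (b :: g) (by simp) b (Finset.mem_univ b)
            ((introspective_initState n).runFrom calls b g hb) a (Finset.mem_univ a)

theorem gossip_connected (n : ℕ) (hn : 2 ≤ n) (G : SimpleGraph (Fin n))
    (hG : G.Connected) (d : ℕ) (hd : 1 ≤ d) :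
    ∃ calls : List (Fin n × Fin n),
      (∀ c ∈ calls, G.Adj c.1 c.2) ∧
      calls.length ≤ d * (2 * n - 3) ∧
      ∀ l : List (Fin n), 2 ≤ l.length → l.length ≤ d + 1 → l ∈ runCalls n calls := by
  obtain ⟨calls, hadj, hlen, hmem⟩ := exists_calls_of_depth hn hG d
  exact ⟨calls, hadj, hlen.le, fun l h₁ h₂ => hmem l (by omega) h₂⟩
end

section
/- For n ≥ 4, if an undirected graph G on n agents contains the complete bipartite graph K_{2,n−2} as a subgraph, then for every d ≥ 1 there exists a call sequence on G of length at most (d+1)(n−2) whose final state contains every fluent of length between 2 and d+1 (so it establishes all positive epistemic goals of depth at most d). -/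
namespace Gossip

variable {n : ℕ}

/-- The state reached from `S` by applying a sequence of calls. -/
def runFrom (S : Set (List (Fin n))) (calls : List (Fin n × Fin n)) : Set (List (Fin n)) :=
  calls.foldl (fun S c => callStep c.1 c.2 S) S

/-- All secrets are true and the known facts are closed under positive introspection. -/
def Introspective (S : Set (List (Fin n))) : Prop :=
  (∀ b, [b] ∈ S) ∧ ∀ b f, b :: f ∈ S → b :: b :: f ∈ S

theorem introspective_initState : Introspective (initState n) := by
  refine ⟨fun b => Or.inl ⟨b, rfl⟩, ?_⟩
  rintro b f (⟨j, hj⟩ | ⟨p, j, hp⟩)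
  · obtain ⟨rfl, rfl⟩ := List.cons_eq_cons.mp hj
    exact Or.inr ⟨[], b, rfl⟩
  · exact Or.inr ⟨b :: p, j, by simp [hp]⟩

theorem subset_callStep (i j : Fin n) (S : Set (List (Fin n))) : S ⊆ callStep i j S :=
  Set.subset_union_left

theorem Introspective.callStep {S : Set (List (Fin n))} (hS : Introspective S) (i j : Fin n) :
    Introspective (callStep i j S) := by
  refine ⟨fun b => Or.inl (hS.1 b), ?_⟩
  rintro b f (h | ⟨w, g, hl, hw, hmem, hg, hk⟩)
  · exact Or.inl (hS.2 b f h)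
  · obtain ⟨c, w, rfl⟩ := List.exists_cons_of_ne_nil hw
    obtain ⟨rfl, rfl⟩ := List.cons_eq_cons.mp hl
    refine Or.inr ⟨b :: b :: w, g, rfl, by simp, ?_, hg, hk⟩
    simpa using hmem

theorem subset_runFrom (S : Set (List (Fin n))) (calls : List (Fin n × Fin n)) :
    S ⊆ runFrom S calls := by
  induction calls generalizing S with
  | nil => exact subset_rfl
  | cons c calls ih => exact (subset_callStep _ _ S).trans (ih _)

theorem Introspective.runFrom {S : Set (List (Fin n))} (hS : Introspective S)
    (calls : List (Fin n × Fin n)) : Introspective (runFrom S calls) := by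
  induction calls generalizing S with
  | nil => exact hS
  | cons c calls ih => exact ih (hS.callStep _ _)

theorem runFrom_append (S : Set (List (Fin n))) (c₁ c₂ : List (Fin n × Fin n)) :
    runFrom S (c₁ ++ c₂) = runFrom (runFrom S c₁) c₂ :=
  List.foldl_append

/-- After a call, both participants know what either knew, and know that both know it. -/
theorem cons_mem_callStep {S : Set (List (Fin n))} (hS : Introspective S) {i j : Fin n}
    {g : List (Fin n)} (hg : i :: g ∈ S ∨ j :: g ∈ S) {a : Fin n} (ha : a = i ∨ a = j) :
    a :: g ∈ callStep i j S ∧ ∀ b, b = i ∨ b = j → a :: b :: g ∈ callStep i j S := by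
  by_cases hne : g = []
  · subst hne
    refine ⟨Or.inl (hS.1 a), fun b hb => Or.inr ⟨[a], [b], rfl, by simp, by simpa using ha,
      by simp, ?_⟩⟩
    have hb' := hS.2 b [] (hS.1 b)
    rcases hb with rfl | rfl
    · exact Or.inl hb'
    · exact Or.inr hb'
  · refine ⟨Or.inr ⟨[a], g, rfl, by simp, by simpa using ha, hne, hg⟩, fun b hb =>
      Or.inr ⟨[a, b], g, rfl, by simp, by simpa using ⟨ha, hb⟩, hne, hg⟩⟩

/-- When a hub `h` calls the agents of `L` in turn, a fact `g` known to `h` or to the first agent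
of `L` becomes known to all of them, and the hub and the last agent know this. -/
theorem cons_mem_runFrom_map {S : Set (List (Fin n))} (hS : Introspective S) (h : Fin n)
    (L : List (Fin n)) (hL : L ≠ []) (g : List (Fin n))
    (hg : h :: g ∈ S ∨ ∃ u ∈ L.head?, u :: g ∈ S) :
    (∀ a, a = h ∨ a ∈ L → a :: g ∈ runFrom S (L.map (Prod.mk h))) ∧
      ∀ x, x = h ∨ x ∈ L.getLast? → ∀ b, b = h ∨ b ∈ L →
        x :: b :: g ∈ runFrom S (L.map (Prod.mk h)) := by
  induction L generalizing S g with
  | nil => exact absurd rfl hL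
  | cons u L ih =>
    have hg' : h :: g ∈ S ∨ u :: g ∈ S := by simpa using hg
    have call := fun a ha => cons_mem_callStep hS hg' (a := a) ha
    rcases eq_or_ne L [] with rfl | hne
    · refine ⟨fun a ha => (call a (by simpa using ha)).1, fun x hx b hb =>
        (call x ?_).2 b (by simpa using hb)⟩
      simpa [eq_comm] using hx
    · have rest := ih (hS.callStep h u) hne g (Or.inl (call h (Or.inl rfl)).1)
      have first := ih (hS.callStep h u) hne (u :: g)
        (Or.inl ((call h (Or.inl rfl)).2 u (Or.inr rfl)))
      constructor
      · intro a ha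
        rcases ha with rfl | ha
        · exact rest.1 a (Or.inl rfl)
        rcases List.mem_cons.mp ha with rfl | ha
        · exact subset_runFrom (callStep h a S) (L.map (Prod.mk h)) (call a (Or.inr rfl)).1
        · exact rest.1 a (Or.inr ha)
      · intro x hx b hb
        have hx' : x = h ∨ x ∈ L.getLast? := by
          rwa [List.getLast?_cons_of_ne_nil hne] at hx
        rcases hb with rfl | hb
        · exact rest.2 x hx' b (Or.inl rfl)
        rcases List.mem_cons.mp hb with rfl | hb
        · exact first.1 x (hx'.imp id List.mem_of_getLast?)
        · exact rest.2 x hx' b (Or.inr hb)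

/-- A round: the hub `h` calls the agents of `L` in turn, and the hub `k` calls `z`. -/
def round (h k : Fin n) (L : List (Fin n)) (z : Fin n) : List (Fin n × Fin n) :=
  L.map (Prod.mk h) ++ [(k, z)]

theorem cons_mem_runFrom_round {S : Set (List (Fin n))} (hS : Introspective S) (h k z : Fin n)
    (L : List (Fin n)) (hL : L ≠ []) (g : List (Fin n))
    (hg : h :: g ∈ S ∨ ∃ u ∈ L.head?, u :: g ∈ S) (hg' : k :: g ∈ S ∨ z :: g ∈ S) :
    (∀ a, (a = h ∨ a ∈ L) ∨ (a = k ∨ a = z) → a :: g ∈ runFrom S (round h k L z)) ∧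
      (∀ x, x = h ∨ x ∈ L.getLast? → ∀ b, b = h ∨ b ∈ L →
        x :: b :: g ∈ runFrom S (round h k L z)) ∧
      ∀ x, x = k ∨ x = z → ∀ b, b = k ∨ b = z → x :: b :: g ∈ runFrom S (round h k L z) := by
  have star := cons_mem_runFrom_map hS h L hL g hg
  have call := fun a ha => cons_mem_callStep (hS.runFrom (L.map (Prod.mk h)))
    (hg'.imp (fun m => subset_runFrom _ _ m) (fun m => subset_runFrom _ _ m)) (a := a) ha
  rw [round, runFrom_append]
  refine ⟨?_, fun x hx b hb => subset_runFrom _ _ (star.2 x hx b hb),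
    fun x hx b hb => (call x hx).2 b hb⟩
  rintro a (ha | ha)
  · exact subset_runFrom _ _ (star.1 a ha)
  · exact (call a ha).1

/-- The invariant after `r + 1` rounds, the last of which is `round h k L z`. -/
def Invariant (S : Set (List (Fin n))) (r : ℕ) (h k : Fin n) (L : List (Fin n)) (z : Fin n) :
    Prop :=
  (∀ g : List (Fin n), g.length ≤ r → ∀ a, a :: g ∈ S) ∧
    ∀ g : List (Fin n), g.length = r →
      (∀ x, x = h ∨ x ∈ L.getLast? → ∀ b, b = h ∨ b ∈ L → x :: b :: g ∈ S) ∧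
      ∀ x, x = k ∨ x = z → ∀ b, b = k ∨ b = z → x :: b :: g ∈ S

theorem invariant_initial_round {h k z : Fin n} {L : List (Fin n)} (hL : L ≠ []) :
    Invariant (runFrom (initState n) (round h k L z)) 0 h k L z := by
  have hS := introspective_initState (n := n)
  have key := cons_mem_runFrom_round hS h k z L hL [] (Or.inl (hS.1 h)) (Or.inl (hS.1 k))
  refine ⟨fun g hg a => ?_, fun g hg => ?_⟩
  · obtain rfl := List.eq_nil_of_length_eq_zero (Nat.le_zero.mp hg)
    exact subset_runFrom _ _ (hS.1 a)
  · obtain rfl := List.eq_nil_of_length_eq_zero hg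
    exact key.2

/-- Exchanging the hubs and reversing the order of the calls advances the invariant. -/
theorem Invariant.runFrom_round {S : Set (List (Fin n))} (hS : Introspective S) {r : ℕ}
    {h k z : Fin n} {L : List (Fin n)} (hL : L ≠ [])
    (cover : ∀ a, (a = h ∨ a ∈ L) ∨ (a = k ∨ a = z)) (inv : Invariant S r k h L.reverse z) :
    Invariant (runFrom S (round h k L z)) (r + 1) h k L z := by
  have key : ∀ g : List (Fin n), g.length = r + 1 → _ := fun g hg =>
    cons_mem_runFrom_round hS h k z L hL g
      (by
        obtain ⟨b, g, rfl⟩ := List.exists_cons_of_length_eq_add_one hg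
        have know := inv.2 g (by simpa using hg)
        obtain ⟨u, T, rfl⟩ := List.exists_cons_of_ne_nil hL
        have := cover b
        by_cases hb : b = h ∨ b = z
        · exact Or.inl (know.2 h (Or.inl rfl) b hb)
        · exact Or.inr ⟨u, rfl, know.1 u (Or.inr (by simp)) b (by simp at this ⊢; tauto)⟩)
      (by
        obtain ⟨b, g, rfl⟩ := List.exists_cons_of_length_eq_add_one hg
        have know := inv.2 g (by simpa using hg)
        have := cover b
        by_cases hb : b = h ∨ b = z
        · exact Or.inr (know.2 z (Or.inr rfl) b hb)
        · exact Or.inl (know.1 k (Or.inl rfl) b (by simp; tauto)))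
  refine ⟨fun g hg a => ?_, fun g hg => (key g hg).2⟩
  rcases Nat.le_succ_iff.mp hg with hg | hg
  · exact subset_runFrom _ _ (inv.1 g hg a)
  · exact (key g hg).1 a (cover a)

theorem adj_of_mem_round {G : SimpleGraph (Fin n)} {h k z : Fin n} {L : List (Fin n)}
    (adj : ∀ v, v = z ∨ v ∈ L → G.Adj h v ∧ G.Adj k v) :
    ∀ c ∈ round h k L z, G.Adj c.1 c.2 := by
  intro c hc
  rcases List.mem_append.mp hc with hc | hc
  · obtain ⟨v, hv, rfl⟩ := List.mem_map.mp hc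
    exact (adj v (Or.inr hv)).1
  · obtain rfl := List.mem_singleton.mp hc
    exact (adj z (Or.inl rfl)).2

theorem exists_calls_invariant (G : SimpleGraph (Fin n)) (r : ℕ) (h k z : Fin n)
    (L : List (Fin n)) (hL : L ≠ []) (cover : ∀ a, a = h ∨ a = k ∨ a = z ∨ a ∈ L)
    (adj : ∀ v, v = z ∨ v ∈ L → G.Adj h v ∧ G.Adj k v) :
    ∃ calls : List (Fin n × Fin n), (∀ c ∈ calls, G.Adj c.1 c.2) ∧
      calls.length = (r + 1) * (L.length + 1) ∧
      Invariant (runFrom (initState n) calls) r h k L z := by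
  induction r generalizing h k L with
  | zero => exact ⟨round h k L z, adj_of_mem_round adj, by simp [round], invariant_initial_round hL⟩
  | succ r ih =>
    obtain ⟨calls, hadj, hlen, inv⟩ := ih k h L.reverse (by simpa using hL)
      (fun a => by have := cover a; simp; tauto)
      (fun v hv => (adj v (by simpa using hv)).symm)
    refine ⟨calls ++ round h k L z, fun c hc => ?_, ?_, ?_⟩
    · exact (List.mem_append.mp hc).elim (hadj c) (adj_of_mem_round adj c)
    · simp only [List.length_append, hlen, round, List.length_map, List.length_reverse,
        List.length_singleton]
      ring
    · rw [runFrom_append]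
      exact inv.runFrom_round (introspective_initState.runFrom calls) hL
        (fun a => by have := cover a; tauto)

end Gossip

theorem gossip_K2 (n : ℕ) (hn : 4 ≤ n) (G : SimpleGraph (Fin n))
    (hK : ∃ i j : Fin n, i ≠ j ∧ ∀ v : Fin n, v ≠ i → v ≠ j → G.Adj i v ∧ G.Adj j v)
    (d : ℕ) (hd : 1 ≤ d) :
    ∃ calls : List (Fin n × Fin n),
      (∀ c ∈ calls, G.Adj c.1 c.2) ∧
      calls.length ≤ (d + 1) * (n - 2) ∧
      ∀ l : List (Fin n), 2 ≤ l.length → l.length ≤ d + 1 → l ∈ runCalls n calls := by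
  obtain ⟨i, j, hij, adj⟩ := hK
  have hcard : (({i, j} : Finset (Fin n))ᶜ).toList.length = n - 2 := by
    rw [Finset.length_toList, Finset.card_compl, Finset.card_pair hij, Fintype.card_fin]
  have hmem : ∀ v, v ∈ (({i, j} : Finset (Fin n))ᶜ).toList ↔ v ≠ i ∧ v ≠ j := by simp
  generalize (({i, j} : Finset (Fin n))ᶜ).toList = M at hcard hmem
  match M, hcard, hmem with
  | [], hcard, _ => simp at hcard; omega
  | z :: L, hcard, hmem =>
    have hlen : L.length + 1 = n - 2 := by simpa using hcard
    have hL : L ≠ [] := by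
      rintro rfl
      simp at hlen
      omega
    obtain ⟨calls, hadj, hcalls, inv⟩ := Gossip.exists_calls_invariant G d i j z L hL
      (fun a => by have := hmem a; simp only [List.mem_cons] at this; tauto)
      (fun v hv => by
        have := (hmem v).mp (List.mem_cons.mpr hv)
        exact adj v this.1 this.2)
    refine ⟨calls, hadj, by rw [hcalls, hlen], fun l h2 hl => ?_⟩
    obtain ⟨a, g, rfl⟩ := List.exists_cons_of_ne_nil (l := l) (by rintro rfl; simp at h2)
    exact inv.1 g (by simpa using hl) a
end

section
/- Let G be a directed graph on n agents (n ≥ 2) and let G̅ be the undirected graph with an edge {i,j} whenever G contains both arcs (i,j) and (j,i). If G̅ has a Hamiltonian path, then for every d ≥ 1 there exists a one-way call sequence on G of length at most (d+1)(n−1) whose final state contains every fluent of length between 2 and d+1 (so it establishes all positive epistemic goals of depth at most d). -/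
/-- A one-way call from agent `i` to agent `j`: the receiver `j` learns everything `i` knows
(and arbitrarily iterated self-knowledge of that), the sender gains nothing. -/
def sendStep {n : ℕ} (i j : Fin n) (S : Set (List (Fin n))) : Set (List (Fin n)) :=
  S ∪ {l | ∃ (k : ℕ) (f : List (Fin n)), 1 ≤ k ∧ f ≠ [] ∧ i :: f ∈ S ∧
        (l = List.replicate k j ++ f ∨ l = List.replicate k j ++ i :: f)}

/-- The state resulting from applying a sequence of one-way calls to the initial state. -/
def runSends (n : ℕ) (calls : List (Fin n × Fin n)) : Set (List (Fin n)) :=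
  calls.foldl (fun S c => sendStep c.1 c.2 S) (initState n)

/-- States containing every fluent `(v)` and closed under repetition of the leading agent. -/
def IsIntrospective {n : ℕ} (S : Set (List (Fin n))) : Prop :=
  (∀ v, [v] ∈ S) ∧ ∀ v f, v :: f ∈ S → v :: v :: f ∈ S

lemma isIntrospective_initState (n : ℕ) : IsIntrospective (initState n) := by
  refine ⟨fun v => Or.inl ⟨v, rfl⟩, ?_⟩
  rintro v f (⟨j, h⟩ | ⟨p, j, h⟩)
  · obtain ⟨rfl, rfl⟩ := List.cons.inj h
    exact Or.inr ⟨[], v, rfl⟩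
  · exact Or.inr ⟨v :: p, j, by rw [h]; rfl⟩

lemma subset_sendStep {n : ℕ} (i j : Fin n) (S : Set (List (Fin n))) : S ⊆ sendStep i j S :=
  Set.subset_union_left

lemma IsIntrospective.sendStep {n : ℕ} {S : Set (List (Fin n))} (hS : IsIntrospective S)
    (i j : Fin n) : IsIntrospective (sendStep i j S) := by
  refine ⟨fun v => subset_sendStep i j S (hS.1 v), ?_⟩
  rintro v f (h | ⟨k, g, hk, hg, hmem, h⟩)
  · exact subset_sendStep i j S (hS.2 v f h)
  · obtain ⟨k, rfl⟩ := Nat.exists_eq_add_of_le' hk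
    refine Or.inr ⟨k + 2, g, by omega, hg, hmem, ?_⟩
    rcases h with h | h
    · left
      simp only [List.replicate_succ, List.cons_append, List.cons.injEq] at h ⊢
      exact ⟨h.1, h.1, h.2⟩
    · right
      simp only [List.replicate_succ, List.cons_append, List.cons.injEq] at h ⊢
      exact ⟨h.1, h.1, h.2⟩

lemma cons_mem_sendStep {n : ℕ} {i : Fin n} {f : List (Fin n)} {S : Set (List (Fin n))}
    (j : Fin n) (hf : f ≠ []) (h : i :: f ∈ S) : j :: f ∈ sendStep i j S :=
  Or.inr ⟨1, f, le_rfl, hf, h, Or.inl rfl⟩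

/-- The effect of a sequence of one-way calls on a state. -/
def applySends {n : ℕ} (calls : List (Fin n × Fin n)) (S : Set (List (Fin n))) :
    Set (List (Fin n)) :=
  calls.foldl (fun S c => sendStep c.1 c.2 S) S

lemma subset_applySends {n : ℕ} (calls : List (Fin n × Fin n)) (S : Set (List (Fin n))) :
    S ⊆ applySends calls S := by
  induction calls generalizing S with
  | nil => exact subset_rfl
  | cons c cs ih => exact (subset_sendStep c.1 c.2 S).trans (ih _)

lemma IsIntrospective.applySends {n : ℕ} {S : Set (List (Fin n))} (hS : IsIntrospective S)
    (calls : List (Fin n × Fin n)) : IsIntrospective (applySends calls S) := by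
  induction calls generalizing S with
  | nil => exact hS
  | cons c cs ih => exact ih (hS.sendStep c.1 c.2)

/-- The calls along consecutive vertices of the path `v :: ws`. -/
def pathCalls {α : Type*} : α → List α → List (α × α)
  | _, [] => []
  | v, w :: ws => (v, w) :: pathCalls w ws

lemma length_pathCalls {α : Type*} (v : α) (ws : List α) :
    (pathCalls v ws).length = ws.length := by
  induction ws generalizing v with
  | nil => rfl
  | cons w ws ih => simp [pathCalls, ih]

lemma rel_of_mem_pathCalls {α : Type*} {R : α → α → Prop} {v : α} {ws : List α}
    (h : (v :: ws).IsChain R) : ∀ c ∈ pathCalls v ws, R c.1 c.2 := by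
  induction ws generalizing v with
  | nil => simp [pathCalls]
  | cons w ws ih =>
    rw [List.isChain_cons_cons] at h
    intro c hc
    rcases List.mem_cons.1 hc with rfl | hc
    · exact h.1
    · exact ih h.2 c hc

/-- Sweeping a path whose first vertex knows all fluents of length at most `t` spreads this
knowledge to the whole path, and its last vertex learns that it has been spread. -/
lemma applySends_pathCalls {n : ℕ} (t : ℕ) (ws : List (Fin n)) (v : Fin n)
    (V : Set (Fin n)) (S : Set (List (Fin n))) (hS : IsIntrospective S)
    (hV : ∀ u ∈ V, ∀ f : List (Fin n), f.length ≤ t → v :: u :: f ∈ S)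
    (hv : ∀ f : List (Fin n), f ≠ [] → f.length ≤ t → v :: f ∈ S) :
    (∀ e ∈ (v :: ws).getLast?, ∀ u, u ∈ V ∨ u ∈ v :: ws → ∀ f : List (Fin n), f.length ≤ t →
      e :: u :: f ∈ applySends (pathCalls v ws) S) ∧
    ∀ w ∈ v :: ws, ∀ f : List (Fin n), f ≠ [] → f.length ≤ t →
      w :: f ∈ applySends (pathCalls v ws) S := by
  have hvv : ∀ f : List (Fin n), f.length ≤ t → v :: v :: f ∈ S := by
    intro f hf
    rcases eq_or_ne f [] with rfl | hne
    · exact hS.2 _ _ (hS.1 v)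
    · exact hS.2 _ _ (hv f hne hf)
  induction ws generalizing v V S with
  | nil =>
    constructor
    · intro e he u hu f hf
      obtain rfl : v = e := by simpa using he
      rcases hu with hu | hu
      · exact hV u hu f hf
      · obtain rfl : u = v := by simpa using hu
        exact hvv f hf
    · intro w hw f hne hf
      obtain rfl : w = v := by simpa using hw
      exact hv f hne hf
  | cons w ws ih =>
    have hS' := hS.sendStep v w
    have hw : ∀ f : List (Fin n), f ≠ [] → f.length ≤ t → w :: f ∈ sendStep v w S :=
      fun f hne hf => cons_mem_sendStep w hne (hv f hne hf)
    have hww : ∀ f : List (Fin n), f.length ≤ t → w :: w :: f ∈ sendStep v w S := by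
      intro f hf
      rcases eq_or_ne f [] with rfl | hne
      · exact hS'.2 _ _ (hS'.1 w)
      · exact hS'.2 _ _ (hw f hne hf)
    obtain ⟨hlast, hall⟩ := ih w (insert v V) (sendStep v w S) hS'
      (by
        rintro u (rfl | hu) f hf
        · exact cons_mem_sendStep w (List.cons_ne_nil _ _) (hvv f hf)
        · exact cons_mem_sendStep w (List.cons_ne_nil _ _) (hV u hu f hf)) hw hww
    constructor
    · intro e he u hu f hf
      refine hlast e (by simpa using he) u ?_ f hf
      rcases hu with hu | hu
      · exact Or.inl (Or.inr hu)
      · rcases List.mem_cons.1 hu with rfl | hu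
        · exact Or.inl (Or.inl rfl)
        · exact Or.inr hu
    · intro x hx f hne hf
      rcases List.mem_cons.1 hx with rfl | hx
      · exact subset_applySends (pathCalls x (w :: ws)) S (hv f hne hf)
      · exact hall x hx f hne hf

/-- Alternating sweeps of a spanning path: after `t + 1` of them every agent knows all fluents of
length at most `t`, and the last vertex knows all fluents of length at most `t + 1`. -/
lemma exists_alternating_sweeps {n : ℕ} {R : Fin n → Fin n → Prop} (hR : ∀ i j, R i j → R j i)
    (t : ℕ) (vs : List (Fin n)) (hvs : vs ≠ []) (hchain : vs.IsChain R) (hmem : ∀ v, v ∈ vs) :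
    ∃ calls : List (Fin n × Fin n), (∀ c ∈ calls, R c.1 c.2) ∧
      calls.length = (t + 1) * (vs.length - 1) ∧
      (∀ e ∈ vs.getLast?, ∀ u (f : List (Fin n)), f.length ≤ t →
        e :: u :: f ∈ runSends n calls) ∧
      ∀ w (f : List (Fin n)), f ≠ [] → f.length ≤ t → w :: f ∈ runSends n calls := by
  induction t generalizing vs with
  | zero =>
    obtain ⟨v, ws, rfl⟩ := List.exists_cons_of_ne_nil hvs
    obtain ⟨hlast, hall⟩ := applySends_pathCalls 0 ws v ∅ (initState n)
      (isIntrospective_initState n) (by simp)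
      (fun f hne hf => absurd (List.length_eq_zero_iff.1 (Nat.le_zero.1 hf)) hne)
    exact ⟨pathCalls v ws, rel_of_mem_pathCalls hchain, by simp [length_pathCalls],
      fun e he u f hf => hlast e he u (Or.inr (hmem u)) f hf,
      fun w f hne hf => hall w (hmem w) f hne hf⟩
  | succ t ih =>
    obtain ⟨v, ws, rfl⟩ := List.exists_cons_of_ne_nil hvs
    obtain ⟨calls, hcalls, hlen, hhead, -⟩ := ih (v :: ws).reverse (by simp)
      (List.isChain_reverse.2 (hchain.imp fun i j h => hR i j h))
      (fun u => List.mem_reverse.2 (hmem u))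
    obtain ⟨hlast, hall⟩ := applySends_pathCalls (t + 1) ws v ∅ (runSends n calls)
      ((isIntrospective_initState n).applySends calls) (by simp) (by
        intro f hne hf
        obtain ⟨u, g, rfl⟩ := List.exists_cons_of_ne_nil hne
        exact hhead v (by simp) u g (by simpa using hf))
    have hrun : runSends n (calls ++ pathCalls v ws) =
        applySends (pathCalls v ws) (runSends n calls) := List.foldl_append
    refine ⟨calls ++ pathCalls v ws, ?_, ?_, ?_, ?_⟩
    · intro c hc
      rcases List.mem_append.1 hc with hc | hc
      · exact hcalls c hc
      · exact rel_of_mem_pathCalls hchain c hc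
    · rw [List.length_append, hlen, length_pathCalls]
      simp only [List.length_reverse, List.length_cons, Nat.add_sub_cancel]
      ring
    · rw [hrun]
      exact fun e he u f hf => hlast e he u (Or.inr (hmem u)) f hf
    · rw [hrun]
      exact fun w f hne hf => hall w (hmem w) f hne hf

theorem directional_gossip_upper (n : ℕ) (hn : 2 ≤ n) (D : Fin n → Fin n → Prop)
    (hHam : ∃ vs : List (Fin n),
      vs.Chain' (fun i j => i ≠ j ∧ D i j ∧ D j i) ∧ vs.Nodup ∧ ∀ v, v ∈ vs)
    (d : ℕ) (hd : 1 ≤ d) :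
    ∃ calls : List (Fin n × Fin n),
      (∀ c ∈ calls, D c.1 c.2) ∧
      calls.length ≤ (d + 1) * (n - 1) ∧
      ∀ l : List (Fin n), 2 ≤ l.length → l.length ≤ d + 1 → l ∈ runSends n calls := by
  obtain ⟨vs, hchain, hnodup, hmem⟩ := hHam
  have hlen : vs.length ≤ n := by simpa using hnodup.length_le_card
  obtain ⟨calls, hcalls, hcard, -, hall⟩ := exists_alternating_sweeps
    (fun i j h => ⟨h.1.symm, h.2.2, h.2.1⟩) d vs
    (List.ne_nil_of_mem (hmem ⟨0, by omega⟩)) hchain hmem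
  refine ⟨calls, fun c hc => (hcalls c hc).2.1, ?_, ?_⟩
  · rw [hcard]
    gcongr
  · intro l hl hl'
    match l, hl, hl' with
    | w :: u :: f, _, hl' =>
      exact hall w (u :: f) (List.cons_ne_nil _ _) (by simpa using hl')
end

section
/- For every d ≥ 1, every directed graph G on n agents (n ≥ 2), and every one-way call sequence on G whose final state contains every fluent of length exactly d+1 (i.e., which establishes T_{d+1}, all positive epistemic goals of depth exactly d), the length of the call sequence is at least (d+1)(n−1). -/
/-- In the state `S`, agent `a` knows every fluent of length `k`. -/
def KnowsAll {n : ℕ} (S : Set (List (Fin n))) (k : ℕ) (a : Fin n) : Prop :=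
  ∀ f : List (Fin n), f.length = k → a :: f ∈ S

theorem runSends_append_singleton {n : ℕ} (p : List (Fin n × Fin n)) (c : Fin n × Fin n) :
    runSends n (p ++ [c]) = sendStep c.1 c.2 (runSends n p) := by
  simp [runSends]

/-- Knowledge is veridical. -/
theorem mem_runSends_of_cons_mem {n : ℕ} (calls : List (Fin n × Fin n)) :
    ∀ (a : Fin n) (f : List (Fin n)), f ≠ [] → a :: f ∈ runSends n calls →
      f ∈ runSends n calls := by
  induction calls using List.reverseRecOn with
  | nil =>
    rintro a f hf (⟨j, hj⟩ | ⟨p, j, hp⟩)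
    · simp_all
    · rcases p with _ | ⟨b, p⟩
      · obtain ⟨rfl, rfl⟩ : a = j ∧ f = [j] := by simpa using hp
        exact Or.inl ⟨_, rfl⟩
      · obtain ⟨rfl, rfl⟩ : a = b ∧ f = p ++ [j, j] := by simpa using hp
        exact Or.inr ⟨p, j, rfl⟩
  | append_singleton p c ih =>
    intro a f hf h
    rw [runSends_append_singleton] at h ⊢
    rcases h with h | ⟨k, g, hk, hg, hS, h⟩
    · exact Or.inl (ih a f hf h)
    · obtain ⟨k, rfl⟩ := Nat.exists_eq_add_of_le' hk
      rcases k with _ | k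
      · rcases h with h | h
        · obtain ⟨rfl, rfl⟩ : a = c.2 ∧ f = g := by simpa using h
          exact Or.inl (ih _ _ hg hS)
        · obtain ⟨rfl, rfl⟩ : a = c.2 ∧ f = c.1 :: g := by simpa using h
          exact Or.inl hS
      · refine Or.inr ⟨k + 1, g, by omega, hg, hS, ?_⟩
        rw [List.replicate_succ] at h
        simp only [List.cons_append, List.cons.injEq] at h
        exact h.imp And.right And.right

/-- A call only changes the knowledge of its receiver. -/
theorem cons_mem_of_mem_sendStep {n : ℕ} {i j a : Fin n} {f : List (Fin n)}
    {S : Set (List (Fin n))} (ha : a ≠ j) (h : a :: f ∈ sendStep i j S) : a :: f ∈ S := by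
  rcases h with h | ⟨k, g, hk, -, -, h⟩
  · exact h
  · obtain ⟨k, rfl⟩ := Nat.exists_eq_add_of_le' hk
    simp only [List.replicate_succ, List.cons_append, List.cons.injEq] at h
    exact absurd (h.elim And.left And.left) ha

/-- An agent receiving no call in `s` learns nothing during `s`. -/
theorem cons_mem_runSends_of_append {n : ℕ} {p s : List (Fin n × Fin n)} {a : Fin n}
    {f : List (Fin n)} (ha : ∀ c ∈ s, a ≠ c.2) (h : a :: f ∈ runSends n (p ++ s)) :
    a :: f ∈ runSends n p := by
  induction s using List.reverseRecOn with
  | nil => simpa using h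
  | append_singleton s c ih =>
    rw [← List.append_assoc, runSends_append_singleton] at h
    exact ih (fun c hc => ha c (by simp [hc])) (cons_mem_of_mem_sendStep (ha c (by simp)) h)

/-- The secret of an agent who never sends is known to nobody else. -/
theorem eq_of_pair_mem_runSends {n : ℕ} {calls : List (Fin n × Fin n)} {j : Fin n}
    (hj : ∀ c ∈ calls, j ≠ c.1) : ∀ {x : Fin n}, [x, j] ∈ runSends n calls → x = j := by
  induction calls using List.reverseRecOn with
  | nil =>
    rintro x (⟨b, hb⟩ | ⟨p, b, hp⟩)
    · simp at hb
    · have hlen : p = [] := by simpa using congrArg List.length hp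
      subst hlen
      obtain ⟨rfl, rfl⟩ : x = b ∧ j = b := by simpa using hp
      rfl
  | append_singleton p c ih =>
    intro x h
    have ih' := @ih fun c hc => hj c (by simp [hc])
    rw [runSends_append_singleton] at h
    rcases h with h | ⟨k, g, hk, hg, hS, h⟩
    · exact ih' h
    · have hpos := List.length_pos_iff.2 hg
      rcases h with h | h
      · have hlen := congrArg List.length h
        simp only [List.length_cons, List.length_nil, List.length_append,
          List.length_replicate] at hlen
        obtain rfl : k = 1 := by omega
        obtain ⟨-, rfl⟩ : x = c.2 ∧ [j] = g := by simpa using h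
        exact absurd (ih' hS).symm (hj c (by simp))
      · have hlen := congrArg List.length h
        simp only [List.length_cons, List.length_nil, List.length_append,
          List.length_replicate] at hlen
        omega

/-- A list whose image covers all agents but one has length at least `n - 1`. -/
theorem pred_le_length_of_forall_ne_mem {n : ℕ} {α : Type*} (s : List α) (g : α → Fin n)
    (x : Fin n) (h : ∀ a, a ≠ x → ∃ c ∈ s, a = g c) : n - 1 ≤ s.length := by
  have hsub : Finset.univ.erase x ⊆ (s.map g).toFinset := by
    intro a ha
    obtain ⟨c, hc, rfl⟩ := h a (Finset.ne_of_mem_erase ha)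
    simpa using ⟨c, hc, rfl⟩
  calc n - 1 = (Finset.univ.erase x).card := by simp
    _ ≤ (s.map g).toFinset.card := Finset.card_le_card hsub
    _ ≤ (s.map g).length := List.toFinset_card_le _
    _ = s.length := by simp

/-- A property of lists failing for `[]` and holding for `l` starts to hold at some prefix. -/
theorem exists_prefix_of_not_nil {α : Type*} {Q : List α → Prop} (h0 : ¬ Q []) (l : List α)
    (hl : Q l) : ∃ p c s, l = p ++ [c] ++ s ∧ ¬ Q p ∧ Q (p ++ [c]) := by
  induction l using List.reverseRecOn with
  | nil => exact absurd hl h0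
  | append_singleton l c ih =>
    by_cases hQ : Q l
    · obtain ⟨p, b, s, rfl, hp, hb⟩ := ih hQ
      exact ⟨p, b, s ++ [c], by simp, hp, hb⟩
    · exact ⟨l, c, [], by simp, hQ, hl⟩

/-- After somebody first knows all fluents of length `k`, every other agent must still receive
a call in order to know them too. -/
theorem succ_mul_le_length_of_forall_knowsAll {n k : ℕ} (hn : 2 ≤ n) (hk : 1 ≤ k)
    (hfirst : ∀ calls : List (Fin n × Fin n),
      (∃ x, KnowsAll (runSends n calls) k x) → k * (n - 1) ≤ calls.length)
    (calls : List (Fin n × Fin n)) (hall : ∀ a, KnowsAll (runSends n calls) k a) :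
    (k + 1) * (n - 1) ≤ calls.length := by
  obtain ⟨p, c, s, rfl, hp, hc⟩ :=
    exists_prefix_of_not_nil (Q := fun l => ∃ x, KnowsAll (runSends n l) k x)
      (fun h => absurd (hfirst [] h)
        (Nat.not_le.2 (Nat.mul_pos (by omega) (by omega))))
      calls ⟨⟨0, by omega⟩, hall _⟩
  have hs : n - 1 ≤ s.length := by
    refine pred_le_length_of_forall_ne_mem s Prod.snd c.2 fun a ha => ?_
    by_contra! hcon
    refine hp ⟨a, fun f hf => ?_⟩
    have h := cons_mem_runSends_of_append hcon (hall a f hf)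
    rw [runSends_append_singleton] at h
    exact cons_mem_of_mem_sendStep ha h
  have := hfirst _ hc
  rw [List.length_append, add_one_mul]
  omega

/-- The first agent to know all fluents of length `k` does so after at least `k * (n - 1)`
calls. -/
theorem mul_le_length_of_exists_knowsAll {n k : ℕ} (hn : 2 ≤ n) (hk : 1 ≤ k) :
    ∀ calls : List (Fin n × Fin n), (∃ x, KnowsAll (runSends n calls) k x) →
      k * (n - 1) ≤ calls.length := by
  induction k, hk using Nat.le_induction with
  | base =>
    rintro calls ⟨x, hx⟩
    rw [one_mul]
    refine pred_le_length_of_forall_ne_mem calls Prod.fst x fun j hj => ?_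
    by_contra! hcon
    exact hj (eq_of_pair_mem_runSends hcon (hx [j] rfl)).symm
  | succ k hk ih =>
    rintro calls ⟨x, hx⟩
    exact succ_mul_le_length_of_forall_knowsAll hn hk ih calls fun a f hf =>
      mem_runSends_of_cons_mem calls x (a :: f) (by simp) (hx _ (by simp [hf]))

theorem directional_gossip_lower (n : ℕ) (hn : 2 ≤ n) (D : Fin n → Fin n → Prop)
    (hirr : ∀ i, ¬ D i i) (d : ℕ) (hd : 1 ≤ d) (calls : List (Fin n × Fin n))
    (hvalid : ∀ c ∈ calls, D c.1 c.2)
    (hgoal : ∀ l : List (Fin n), l.length = d + 1 → l ∈ runSends n calls) :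
    (d + 1) * (n - 1) ≤ calls.length := by
  exact succ_mul_le_length_of_forall_knowsAll hn hd (mul_le_length_of_exists_knowsAll hn hd) calls
    fun a f hf => hgoal (a :: f) (by simp [hf])
end

section
/- For n ≥ 2, if an undirected graph G on n agents contains the complete bipartite graph K_{⌈n/2⌉,⌊n/2⌋} as a subgraph, then for every d ≥ 1 there exists a parallel protocol on G using at most d(⌈log₂ n⌉ − 1) + 1 steps if n is even, and at most d⌈log₂ n⌉ + 1 steps if n is odd, whose final state contains every fluent of length between 2 and d+1 (so it establishes all positive epistemic goals of depth at most d). -/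
/-- A parallel step: all calls of the matching `M` are evaluated on the pre-step state. -/
def parStep {n : ℕ} (M : List (Fin n × Fin n)) (S : Set (List (Fin n))) : Set (List (Fin n)) :=
  S ∪ {l | ∃ c ∈ M, ∃ w f : List (Fin n), l = w ++ f ∧ w ≠ [] ∧
        (∀ a ∈ w, a = c.1 ∨ a = c.2) ∧ f ≠ [] ∧ (c.1 :: f ∈ S ∨ c.2 :: f ∈ S)}

/-- A matching: pairwise disjoint edges, each between two distinct agents. -/
def IsMatching {n : ℕ} (M : List (Fin n × Fin n)) : Prop :=
  (∀ c ∈ M, c.1 ≠ c.2) ∧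
  M.Pairwise fun c c' => c.1 ≠ c'.1 ∧ c.1 ≠ c'.2 ∧ c.2 ≠ c'.1 ∧ c.2 ≠ c'.2

/-- The state resulting from applying a sequence of parallel steps to the initial state. -/
def runPar (n : ℕ) (steps : List (List (Fin n × Fin n))) : Set (List (Fin n)) :=
  steps.foldl (fun S M => parStep M S) (initState n)

namespace ParallelGossip

variable {n : ℕ}

theorem subset_parStep (M : List (Fin n × Fin n)) (S : Set (List (Fin n))) : S ⊆ parStep M S :=
  Set.subset_union_left

theorem mem_parStep {M : List (Fin n × Fin n)} {S : Set (List (Fin n))} {p q : Fin n}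
    (hM : (p, q) ∈ M) {w f : List (Fin n)} (hw : w ≠ []) (hwpq : ∀ c ∈ w, c = p ∨ c = q)
    (hf : f ≠ []) (h : p :: f ∈ S ∨ q :: f ∈ S) : w ++ f ∈ parStep M S :=
  Or.inr ⟨(p, q), hM, w, f, rfl, hw, hwpq, hf, h⟩

/-- The state reached from `S` by a sequence of parallel steps. -/
def run (S : Set (List (Fin n))) (steps : List (List (Fin n × Fin n))) : Set (List (Fin n)) :=
  steps.foldl (fun S M => parStep M S) S

theorem run_append (S : Set (List (Fin n))) (l₁ l₂ : List (List (Fin n × Fin n))) :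
    run S (l₁ ++ l₂) = run (run S l₁) l₂ :=
  List.foldl_append

theorem run_concat (S : Set (List (Fin n))) (l : List (List (Fin n × Fin n)))
    (M : List (Fin n × Fin n)) : run S (l ++ [M]) = parStep M (run S l) := by
  simp [run]

theorem subset_run (S : Set (List (Fin n))) (steps : List (List (Fin n × Fin n))) :
    S ⊆ run S steps := by
  induction steps generalizing S with
  | nil => exact subset_rfl
  | cons M steps ih => exact (subset_parStep M S).trans (ih _)

theorem pair_mem_initState (x : Fin n) : [x, x] ∈ initState n :=
  Or.inr ⟨[], x, rfl⟩

/-- Every call of the step `M` is along an edge of `G`, and `M` is a matching. -/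
def IsStep (G : SimpleGraph (Fin n)) (M : List (Fin n × Fin n)) : Prop :=
  IsMatching M ∧ ∀ c ∈ M, G.Adj c.1 c.2

variable {N : ℕ} [NeZero N]

/-- The matching in which `a i` calls `b (i + s)`. -/
noncomputable def shiftMatching (a b : ZMod N → Fin n) (s : ZMod N) : List (Fin n × Fin n) :=
  (Finset.univ : Finset (ZMod N)).toList.map fun i => (a i, b (i + s))

theorem mem_shiftMatching (a b : ZMod N → Fin n) (s i : ZMod N) :
    (a i, b (i + s)) ∈ shiftMatching a b s :=
  List.mem_map.2 ⟨i, by simp, rfl⟩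

theorem isStep_shiftMatching {G : SimpleGraph (Fin n)} {a b : ZMod N → Fin n}
    (ha : Function.Injective a) (hb : Function.Injective b) (hG : ∀ i j, G.Adj (a i) (b j))
    (s : ZMod N) : IsStep G (shiftMatching a b s) := by
  refine ⟨⟨?_, ?_⟩, ?_⟩
  · intro c hc
    obtain ⟨i, -, rfl⟩ := List.mem_map.1 hc
    exact (hG _ _).ne
  · refine List.pairwise_map.2 ((Finset.nodup_toList _).imp ?_)
    intro i j hij
    exact ⟨ha.ne hij, (hG _ _).ne, (hG _ _).ne', hb.ne fun h => hij (add_right_cancel h)⟩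
  · intro c hc
    obtain ⟨i, -, rfl⟩ := List.mem_map.1 hc
    exact hG _ _

/-- The agents `a i` and `b (i + s)` have common knowledge, up to any depth, of every fluent
`y :: f` with `y ∈ Y i` and `f` of length `d`. -/
def PairKnows (a b : ZMod N → Fin n) (S : Set (List (Fin n))) (s : ZMod N) (d : ℕ)
    (Y : ZMod N → Set (Fin n)) : Prop :=
  ∀ i, ∀ y ∈ Y i, ∀ f : List (Fin n), f.length = d → ∀ w : List (Fin n), w ≠ [] →
    (∀ c ∈ w, c = a i ∨ c = b (i + s)) → w ++ y :: f ∈ S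

theorem PairKnows.step {a b : ZMod N → Fin n} {S : Set (List (Fin n))} {s : ZMod N} {d : ℕ}
    {Y : ZMod N → Set (Fin n)} (h : PairKnows a b S s d Y) (L : ZMod N) :
    PairKnows a b (parStep (shiftMatching a b (s + L)) S) (s + L) d
      fun i => Y i ∪ Y (i + L) := by
  intro i y hy f hf w hw hwi
  refine mem_parStep (mem_shiftMatching a b (s + L) i) hw hwi (by simp) ?_
  rcases hy with hy | hy
  · exact Or.inl (h i y hy f hf [a i] (by simp) (by simp))
  · refine Or.inr (h (i + L) y hy f hf [b (i + (s + L))] (by simp) ?_)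
    have : i + L + s = i + (s + L) := by ring
    simp [this]

theorem PairKnows.exists_doubling {G : SimpleGraph (Fin n)} {a b : ZMod N → Fin n}
    (ha : Function.Injective a) (hb : Function.Injective b) (hG : ∀ i j, G.Adj (a i) (b j))
    {S : Set (List (Fin n))} {s : ZMod N} {d : ℕ} {Y : ZMod N → Set (Fin n)}
    (h : PairKnows a b S s d Y) (k : ℕ) :
    ∃ steps : List (List (Fin n × Fin n)), (∀ M ∈ steps, IsStep G M) ∧ steps.length = k ∧
      ∃ s', PairKnows a b (run S steps) s' d fun i => {y | ∃ j < 2 ^ k, y ∈ Y (i + (j : ℕ))} := by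
  induction k with
  | zero =>
    refine ⟨[], by simp, rfl, s, ?_⟩
    intro i y hy
    obtain ⟨j, hj, hy⟩ := hy
    obtain rfl : j = 0 := by simpa using hj
    exact h i y (by simpa using hy)
  | succ k ih =>
    obtain ⟨steps, hsteps, hlen, s', hs'⟩ := ih
    refine ⟨steps ++ [shiftMatching a b (s' + (2 ^ k : ℕ))], ?_, by simp [hlen],
      s' + (2 ^ k : ℕ), ?_⟩
    · intro M hM
      rcases List.mem_append.1 hM with hM | hM
      · exact hsteps M hM
      · obtain rfl := List.mem_singleton.1 hM
        exact isStep_shiftMatching ha hb hG _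
    · rw [run_concat]
      intro i y hy
      refine hs'.step _ i y ?_
      obtain ⟨j, hj, hy⟩ := hy
      by_cases hjk : j < 2 ^ k
      · exact Or.inl ⟨j, hjk, hy⟩
      · refine Or.inr ⟨j - 2 ^ k, by rw [pow_succ] at hj; omega, ?_⟩
        rw [add_assoc, ← Nat.cast_add, Nat.add_sub_cancel' (not_lt.1 hjk)]
        exact hy

theorem PairKnows.exists_gossip {G : SimpleGraph (Fin n)} {a b : ZMod N → Fin n}
    (ha : Function.Injective a) (hb : Function.Injective b) (hG : ∀ i j, G.Adj (a i) (b j))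
    {S : Set (List (Fin n))} {s : ZMod N} {d : ℕ} {Y : ZMod N → Set (Fin n)}
    (h : PairKnows a b S s d Y) (hY : ∀ y, ∃ i, y ∈ Y i) {k : ℕ} (hk : N ≤ 2 ^ k) :
    ∃ steps : List (List (Fin n × Fin n)), (∀ M ∈ steps, IsStep G M) ∧ steps.length = k ∧
      ∃ s', PairKnows a b (run S steps) s' d fun _ => Set.univ := by
  obtain ⟨steps, hsteps, hlen, s', hs'⟩ := h.exists_doubling ha hb hG k
  refine ⟨steps, hsteps, hlen, s', fun i y _ => hs' i y ?_⟩
  obtain ⟨i', hi'⟩ := hY y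
  exact ⟨(i' - i).val, (ZMod.val_lt _).trans_le hk, by simpa using hi'⟩

theorem exists_steps_of_perfect {G : SimpleGraph (Fin n)} {a b : ZMod N → Fin n}
    (ha : Function.Injective a) (hb : Function.Injective b) (hG : ∀ i j, G.Adj (a i) (b j))
    (hab : ∀ x, (∃ i, x = a i) ∨ ∃ i, x = b i) {k : ℕ} (hk : N ≤ 2 ^ k) (d : ℕ) :
    ∃ steps : List (List (Fin n × Fin n)), (∀ M ∈ steps, IsStep G M) ∧
      steps.length = d * k + 1 ∧
      (∀ l : List (Fin n), 2 ≤ l.length → l.length ≤ d + 1 → l ∈ run (initState n) steps) ∧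
      ∃ s, PairKnows a b (run (initState n) steps) s d fun i => {a i, b (i + s)} := by
  have cover (s : ZMod N) (x : Fin n) : ∃ i, x = a i ∨ x = b (i + s) := by
    rcases hab x with ⟨i, rfl⟩ | ⟨i, rfl⟩
    · exact ⟨i, Or.inl rfl⟩
    · exact ⟨i - s, Or.inr (by simp)⟩
  induction d with
  | zero =>
    refine ⟨[shiftMatching a b 0], ?_, by simp, fun l h₁ h₂ => by omega, 0, ?_⟩
    · simpa using isStep_shiftMatching ha hb hG 0
    · intro i y hy f hf w hw hwi
      obtain rfl := List.length_eq_zero_iff.1 hf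
      refine mem_parStep (mem_shiftMatching a b 0 i) hw hwi (by simp) ?_
      rcases hy with rfl | rfl
      · exact Or.inl (pair_mem_initState _)
      · exact Or.inr (pair_mem_initState _)
  | succ d ih =>
    obtain ⟨steps, hsteps, hlen, hall, s, hs⟩ := ih
    obtain ⟨steps', hsteps', hlen', s', hs'⟩ :=
      hs.exists_gossip ha hb hG (fun y => cover s y) hk
    refine ⟨steps ++ steps', ?_, by simp [hlen, hlen']; ring, ?_, s', ?_⟩
    · intro M hM
      exact (List.mem_append.1 hM).elim (hsteps M) (hsteps' M)
    · intro l h₁ h₂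
      rw [run_append]
      by_cases hl : l.length ≤ d + 1
      · exact subset_run _ _ (hall l h₁ hl)
      · match l, h₁, h₂, hl with
        | x :: y :: f, _, h₂, hl =>
          obtain ⟨i, hi⟩ := cover s' x
          exact hs' i y trivial f (by simp at h₂ hl; omega) [x] (by simp) (by simpa using hi)
    · rw [run_append]
      intro i y hy f hf w hw hwi
      match f, hf with
      | z :: f, hf =>
        have := hs' i z trivial f (by simpa using hf) (w ++ [y]) (by simp) (by
          intro c hc
          rcases List.mem_append.1 hc with hc | hc
          · exact hwi c hc
          · obtain rfl := List.mem_singleton.1 hc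
            exact hy)
        simpa using this

theorem exists_steps_of_folding {G : SimpleGraph (Fin n)} {a b : ZMod N → Fin n}
    (ha : Function.Injective a) (hb : Function.Injective b) (hG : ∀ i j, G.Adj (a i) (b j))
    {F : List (Fin n × Fin n)} (hF : IsStep G F)
    (hab : ∀ x, ((∃ i, x = a i) ∨ ∃ i, x = b i) ∨
      ∃ y, ((∃ i, y = a i) ∨ ∃ i, y = b i) ∧ (y, x) ∈ F)
    {k : ℕ} (hk : N ≤ 2 ^ k) (d : ℕ) :
    ∃ steps : List (List (Fin n × Fin n)), (∀ M ∈ steps, IsStep G M) ∧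
      steps.length = d * (k + 2) + 1 ∧
      (∀ l : List (Fin n), 2 ≤ l.length → l.length ≤ d + 1 → l ∈ run (initState n) steps) ∧
      ∀ x, ((∃ i, x = a i) ∨ ∃ i, x = b i) → ∀ y, (y = x ∨ (x, y) ∈ F) →
        ∀ f : List (Fin n), f.length = d → x :: y :: f ∈ run (initState n) steps := by
  induction d with
  | zero =>
    refine ⟨[F], by simpa using hF, by simp, fun l h₁ h₂ => by omega, ?_⟩
    intro x _ y hy f hf
    obtain rfl := List.length_eq_zero_iff.1 hf
    rcases hy with rfl | hy
    · exact subset_run _ _ (pair_mem_initState _)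
    · exact mem_parStep (w := [x]) hy (by simp) (by simp) (by simp)
        (Or.inr (pair_mem_initState y))
  | succ d ih =>
    obtain ⟨steps, hsteps, hlen, hall, hcore⟩ := ih
    have h₀ : PairKnows a b (parStep (shiftMatching a b 0) (run (initState n) steps)) 0 d
        fun i => {y | (y = a i ∨ (a i, y) ∈ F) ∨ (y = b i ∨ (b i, y) ∈ F)} := by
      intro i y hy f hf w hw hwi
      refine mem_parStep (mem_shiftMatching a b 0 i) hw hwi (by simp) ?_
      rw [add_zero]
      exact hy.imp (fun h => hcore _ (Or.inl ⟨i, rfl⟩) y h f hf)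
        (fun h => hcore _ (Or.inr ⟨i, rfl⟩) y h f hf)
    obtain ⟨steps', hsteps', hlen', s, hs⟩ := h₀.exists_gossip ha hb hG (by
      intro y
      rcases hab y with (⟨i, hi⟩ | ⟨i, hi⟩) | ⟨x, ⟨i, rfl⟩ | ⟨i, rfl⟩, hx⟩
      · exact ⟨i, Or.inl (Or.inl hi)⟩
      · exact ⟨i, Or.inr (Or.inl hi)⟩
      · exact ⟨i, Or.inl (Or.inr hx)⟩
      · exact ⟨i, Or.inr (Or.inr hx)⟩) hk
    rw [← run_concat, ← run_append] at hs
    set pre := steps ++ [shiftMatching a b 0] ++ steps' with hpre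
    have hrep (x : Fin n) (hx : (∃ i, x = a i) ∨ ∃ i, x = b i) (w : List (Fin n)) (hw : w ≠ [])
        (hwx : ∀ c ∈ w, c = x) (y : Fin n) (f : List (Fin n)) (hf : f.length = d) :
        w ++ y :: f ∈ run (initState n) pre := by
      rcases hx with ⟨i, rfl⟩ | ⟨i, rfl⟩
      · exact hs i y trivial f hf w hw fun c hc => Or.inl (hwx c hc)
      · exact hs (i - s) y trivial f hf w hw fun c hc => Or.inr (by simpa using hwx c hc)
    refine ⟨pre ++ [F], ?_, by simp [hpre, hlen, hlen']; ring, ?_, ?_⟩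
    · intro M hM
      simp only [hpre, List.mem_append, List.mem_singleton] at hM
      rcases hM with ((hM | rfl) | hM) | rfl
      · exact hsteps M hM
      · exact isStep_shiftMatching ha hb hG 0
      · exact hsteps' M hM
      · exact hF
    · intro l h₁ h₂
      by_cases hl : l.length ≤ d + 1
      · rw [hpre, List.append_assoc, List.append_assoc, run_append]
        exact subset_run _ _ (hall l h₁ hl)
      · rw [run_concat]
        match l, h₁, h₂, hl with
        | x :: y :: f, _, h₂, hl =>
          have hf : f.length = d := by simp at h₂ hl; omega
          rcases hab x with hx | ⟨z, hz, hzx⟩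
          · exact subset_parStep _ _ (hrep x hx [x] (by simp) (by simp) y f hf)
          · exact mem_parStep (w := [x]) hzx (by simp) (by simp) (by simp)
              (Or.inl (hrep z hz [z] (by simp) (by simp) y f hf))
    · intro x hx y hy f hf
      rw [run_concat]
      match f, hf with
      | z :: f, hf =>
        have hf : f.length = d := by simpa using hf
        rcases hy with rfl | hy
        · exact subset_parStep _ _ (hrep y hx [y, y] (by simp) (by simp) z f hf)
        · exact mem_parStep (w := [x, y]) hy (by simp) (by simp) (by simp)
            (Or.inl (hrep x hx [x] (by simp) (by simp) z f hf))

theorem exists_enumeration (A : Finset (Fin n)) (hA : A.card = N) :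
    ∃ a : ZMod N → Fin n, Function.Injective a ∧ ∀ x, x ∈ A ↔ ∃ i, x = a i := by
  have e : ZMod N ≃ A := Fintype.equivOfCardEq (by simp [ZMod.card, hA])
  refine ⟨fun i => e i, Subtype.val_injective.comp e.injective, fun x => ⟨fun hx => ?_, ?_⟩⟩
  · exact ⟨e.symm ⟨x, hx⟩, by simp⟩
  · rintro ⟨i, rfl⟩
    exact (e i).2

theorem exists_injOn_mapsTo {α : Type*} {s t : Finset α} (h : s.card ≤ t.card) :
    ∃ g : α → α, Set.InjOn g s ∧ ∀ x ∈ s, g x ∈ t := by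
  classical
  obtain ⟨g⟩ := Function.Embedding.nonempty_of_card_le (α := s) (β := t) (by simpa using h)
  refine ⟨fun x => if hx : x ∈ s then g ⟨x, hx⟩ else x, ?_, ?_⟩
  · intro x hx y hy hxy
    have hx : x ∈ s := hx
    have hy : y ∈ s := hy
    simp only [hx, hy, dif_pos] at hxy
    simpa using g.injective (Subtype.ext hxy)
  · intro x hx
    simp [hx]

theorem exists_folding {G : SimpleGraph (Fin n)} {V A B : Finset (Fin n)}
    (hV : ∀ i ∈ V, ∀ j ∉ V, G.Adj i j) (hA : A ⊆ V) (hB : B ⊆ Vᶜ)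
    (hAB : (V \ A).card ≤ B.card) (hBA : (Vᶜ \ B).card ≤ A.card) :
    ∃ F, IsStep G F ∧ ∀ x, (x ∈ A ∨ x ∈ B) ∨ ∃ y, (y ∈ A ∨ y ∈ B) ∧ (y, x) ∈ F := by
  obtain ⟨g, hg, hgB⟩ := exists_injOn_mapsTo hAB
  obtain ⟨h, hh, hhA⟩ := exists_injOn_mapsTo hBA
  have hB' (x) (hx : x ∈ B) : x ∉ V := Finset.mem_compl.1 (hB hx)
  let φ : Fin n → Fin n := fun x => if x ∈ V then g x else h x
  have hφ (x) (hx : ¬(x ∈ A ∨ x ∈ B)) :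
      (x ∈ V ∧ φ x = g x ∧ φ x ∈ B ∧ x ∈ V \ A) ∨ (x ∉ V ∧ φ x = h x ∧ φ x ∈ A ∧ x ∈ Vᶜ \ B) := by
    push Not at hx
    by_cases hxV : x ∈ V
    · have hm : x ∈ V \ A := by simp [hxV, hx.1]
      exact Or.inl ⟨hxV, by simp [φ, hxV], by simpa [φ, hxV] using hgB x hm, hm⟩
    · have hm : x ∈ Vᶜ \ B := by simp [hxV, hx.2]
      exact Or.inr ⟨hxV, by simp [φ, hxV], by simpa [φ, hxV] using hhA x hm, hm⟩
  have hcore (x) (hx : ¬(x ∈ A ∨ x ∈ B)) : φ x ∈ A ∨ φ x ∈ B :=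
    (hφ x hx).elim (fun h => Or.inr h.2.2.1) (fun h => Or.inl h.2.2.1)
  have hadj (x) (hx : ¬(x ∈ A ∨ x ∈ B)) : G.Adj (φ x) x := by
    rcases hφ x hx with ⟨h₁, -, h₂, -⟩ | ⟨h₁, -, h₂, -⟩
    · exact (hV _ h₁ _ (hB' _ h₂)).symm
    · exact hV _ (hA h₂) _ h₁
  have hinj (x y) (hx : ¬(x ∈ A ∨ x ∈ B)) (hy : ¬(y ∈ A ∨ y ∈ B)) (hxy : φ x = φ y) : x = y := by
    rcases hφ x hx with ⟨-, ex, mx, sx⟩ | ⟨-, ex, mx, sx⟩ <;>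
      rcases hφ y hy with ⟨-, ey, my, sy⟩ | ⟨-, ey, my, sy⟩
    · exact hg sx sy (by rw [← ex, ← ey, hxy])
    · exact absurd (hA my) (hB' _ (hxy ▸ mx))
    · exact absurd (hA mx) (hB' _ (hxy ▸ my))
    · exact hh sx sy (by rw [← ex, ← ey, hxy])
  let T : Finset (Fin n) := Finset.univ.filter fun x => ¬(x ∈ A ∨ x ∈ B)
  have hT (x) : x ∈ T.toList ↔ ¬(x ∈ A ∨ x ∈ B) := by simp [T]
  refine ⟨T.toList.map fun x => (φ x, x), ⟨⟨?_, ?_⟩, ?_⟩, ?_⟩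
  · intro c hc
    obtain ⟨x, hx, rfl⟩ := List.mem_map.1 hc
    exact (hadj x ((hT x).1 hx)).ne
  · refine List.pairwise_map.2 ((Finset.nodup_toList T).imp_of_mem ?_)
    intro x y hx hy hxy
    rw [hT] at hx hy
    exact ⟨fun e => hxy (hinj x y hx hy e), fun (e : φ x = y) => hy (e ▸ hcore x hx),
      fun (e : x = φ y) => hx (e ▸ hcore y hy), hxy⟩
  · intro c hc
    obtain ⟨x, hx, rfl⟩ := List.mem_map.1 hc
    exact hadj x ((hT x).1 hx)
  · intro x
    by_cases hx : x ∈ A ∨ x ∈ B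
    · exact Or.inl hx
    · exact Or.inr ⟨φ x, hcore x hx, List.mem_map.2 ⟨x, (hT x).2 hx, rfl⟩⟩

end ParallelGossip

open ParallelGossip in
theorem parallel_gossip_upper (n : ℕ) (hn : 2 ≤ n) (G : SimpleGraph (Fin n))
    (hK : ∃ V : Finset (Fin n), V.card = (n + 1) / 2 ∧ ∀ i ∈ V, ∀ j ∉ V, G.Adj i j)
    (d : ℕ) (hd : 1 ≤ d) :
    ∃ steps : List (List (Fin n × Fin n)),
      (∀ M ∈ steps, IsMatching M ∧ ∀ c ∈ M, G.Adj c.1 c.2) ∧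
      steps.length ≤
        (if Even n then d * (Nat.clog 2 n - 1) + 1 else d * Nat.clog 2 n + 1) ∧
      ∀ l : List (Fin n), 2 ≤ l.length → l.length ≤ d + 1 → l ∈ runPar n steps := by
  obtain ⟨V, hcard, hV⟩ := hK
  have hcompl : Vᶜ.card = n - (n + 1) / 2 := by rw [Finset.card_compl, hcard, Fintype.card_fin]
  have hle : n ≤ 2 ^ Nat.clog 2 n := Nat.le_pow_clog one_lt_two n
  have hlt : 2 ^ (Nat.clog 2 n - 1) < n := Nat.pow_pred_clog_lt_self one_lt_two hn
  have hpos : 0 < Nat.clog 2 n := Nat.clog_pos one_lt_two hn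
  split_ifs with hpar
  · obtain ⟨m, hm⟩ := hpar
    have : NeZero m := ⟨by omega⟩
    obtain ⟨a, ha, haV⟩ := exists_enumeration (N := m) V (by omega)
    obtain ⟨b, hb, hbV⟩ := exists_enumeration (N := m) Vᶜ (by omega)
    obtain ⟨k, hk⟩ : ∃ k, Nat.clog 2 n = k + 1 := ⟨_, (Nat.succ_pred_eq_of_pos hpos).symm⟩
    rw [hk, pow_succ] at hle
    obtain ⟨steps, hsteps, hlen, hall, -⟩ := exists_steps_of_perfect (G := G) ha hb
      (fun i j => hV _ ((haV _).2 ⟨i, rfl⟩) _ (Finset.mem_compl.1 ((hbV _).2 ⟨j, rfl⟩)))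
      (fun x => by rw [← haV, ← hbV, Finset.mem_compl]; exact em _) (k := k) (by omega) d
    exact ⟨steps, hsteps, by rw [hlen, hk, Nat.add_sub_cancel], hall⟩
  · obtain ⟨m, hm⟩ := Nat.not_even_iff_odd.1 hpar
    obtain ⟨k, hk⟩ : ∃ k, Nat.clog 2 n = k + 2 := by
      refine ⟨Nat.clog 2 n - 2, ?_⟩
      have : Nat.clog 2 n ≠ 1 := by
        intro h
        rw [h] at hle
        omega
      omega
    have hk' : k + 2 - 1 = k + 1 := rfl
    rw [hk, pow_add] at hle
    rw [hk, hk', pow_succ] at hlt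
    obtain ⟨A, hA, hAcard⟩ := Finset.exists_subset_card_eq (s := V) (n := 2 ^ k) (by omega)
    obtain ⟨B, hB, hBcard⟩ := Finset.exists_subset_card_eq (s := Vᶜ) (n := 2 ^ k) (by omega)
    obtain ⟨a, ha, haA⟩ := exists_enumeration (N := 2 ^ k) A hAcard
    obtain ⟨b, hb, hbB⟩ := exists_enumeration (N := 2 ^ k) B hBcard
    obtain ⟨F, hF, hcover⟩ := exists_folding hV hA hB
      (by rw [Finset.card_sdiff_of_subset hA]; omega)
      (by rw [Finset.card_sdiff_of_subset hB]; omega)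
    obtain ⟨steps, hsteps, hlen, hall, -⟩ := exists_steps_of_folding (G := G) ha hb
      (fun i j => hV _ (hA ((haA _).2 ⟨i, rfl⟩)) _
        (Finset.mem_compl.1 (hB ((hbB _).2 ⟨j, rfl⟩))))
      hF (fun x => by simpa only [haA, hbB] using hcover x) le_rfl d
    exact ⟨steps, hsteps, by rw [hlen, hk], hall⟩
end

section
/- Let G be an undirected graph on n agents (n ≥ 2) and consider an instance of Gossip-neg on G with m goals, each goal fluent having length at most d+1. If some call sequence on G satisfies all the goals, then there is a call sequence on G of length at most m·d·(n−1) that satisfies all the goals. -/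
theorem subset_callStep {n : ℕ} (i j : Fin n) (S : Set (List (Fin n))) : S ⊆ callStep i j S :=
  Set.subset_union_left

theorem callStep_mono {n : ℕ} (i j : Fin n) {S T : Set (List (Fin n))} (h : S ⊆ T) :
    callStep i j S ⊆ callStep i j T := by
  rintro l (hl | ⟨w, f, hlw, hw, hwij, hf, hS⟩)
  · exact Or.inl (h hl)
  · exact Or.inr ⟨w, f, hlw, hw, hwij, hf, hS.imp (@h _) (@h _)⟩

theorem runCalls_concat (n : ℕ) (calls : List (Fin n × Fin n)) (c : Fin n × Fin n) :
    runCalls n (calls ++ [c]) = callStep c.1 c.2 (runCalls n calls) := by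
  simp [runCalls]

/-- Omitting calls can only make fewer fluents true. -/
theorem runCalls_subset_of_sublist {n : ℕ} {xs ys : List (Fin n × Fin n)}
    (h : xs.Sublist ys) : runCalls n xs ⊆ runCalls n ys := by
  suffices H : ∀ S T : Set (List (Fin n)), S ⊆ T →
      xs.foldl (fun S c => callStep c.1 c.2 S) S ⊆ ys.foldl (fun S c => callStep c.1 c.2 S) T from
    H _ _ subset_rfl
  induction h with
  | slnil => exact fun S T hST => hST
  | cons c _ ih => exact fun S T hST => ih _ _ (hST.trans (subset_callStep _ _ _))
  | cons_cons c _ ih => exact fun S T hST => ih _ _ (callStep_mono _ _ hST)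

/-- Two sublists of `l` are jointly contained in a sublist of `l` no longer than their total. -/
theorem List.Sublist.exists_common_superlist {α : Type*} {l : List α} :
    ∀ {xs ys : List α}, xs.Sublist l → ys.Sublist l →
      ∃ zs, zs.Sublist l ∧ xs.Sublist zs ∧ ys.Sublist zs ∧ zs.length ≤ xs.length + ys.length := by
  induction l with
  | nil =>
    intro xs ys hx hy
    obtain rfl := List.sublist_nil.1 hx
    obtain rfl := List.sublist_nil.1 hy
    exact ⟨[], by simp⟩
  | cons a l ih =>
    intro xs ys hx hy
    rcases hx with _ | ⟨_, hx⟩ | ⟨_, hx⟩ <;> rcases hy with _ | ⟨_, hy⟩ | ⟨_, hy⟩ <;>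
      obtain ⟨zs, hz, hxz, hyz, hlen⟩ := ih hx hy
    · exact ⟨zs, hz.cons a, hxz, hyz, hlen⟩
    · exact ⟨a :: zs, hz.cons_cons a, hxz.cons a, hyz.cons_cons a, by simp; omega⟩
    · exact ⟨a :: zs, hz.cons_cons a, hxz.cons_cons a, hyz.cons a, by simp; omega⟩
    · exact ⟨a :: zs, hz.cons_cons a, hxz.cons_cons a, hyz.cons_cons a, by simp; omega⟩

/-- The set of agents who know the fluent `f` in the state `S`. -/
def knowers {n : ℕ} (S : Set (List (Fin n))) (f : List (Fin n)) : Set (Fin n) :=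
  {a | a :: f ∈ S}

theorem ncard_knowers_le {n : ℕ} (S : Set (List (Fin n))) (f : List (Fin n)) :
    (knowers S f).ncard ≤ n := by
  simpa using Set.ncard_le_card (knowers S f)

/-- Every true fluent `a :: f` is already made true by few of the calls: at most `n - 1` for each
entry of `f` but the first, plus one less than the number of agents who know `f`. -/
theorem exists_sublist_mem_runCalls_of_knowers {n : ℕ} (calls : List (Fin n × Fin n))
    (hne : ∀ c ∈ calls, c.1 ≠ c.2) (a : Fin n) (f : List (Fin n)) (hf : f ≠ [])
    (h : a :: f ∈ runCalls n calls) :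
    ∃ xs, xs.Sublist calls ∧ a :: f ∈ runCalls n xs ∧
      xs.length + 1 + (n - 1) ≤ f.length * (n - 1) + (knowers (runCalls n calls) f).ncard := by
  induction calls using List.reverseRecOn generalizing a f with
  | nil =>
    refine ⟨[], List.Sublist.refl _, h, ?_⟩
    have hpos : 0 < (knowers (runCalls n []) f).ncard := (Set.ncard_pos).2 ⟨a, h⟩
    have := Nat.mul_le_mul_right (n - 1) (List.length_pos_iff.2 hf)
    simp only [List.length_nil]
    omega
  | append_singleton cs c ih =>
    have ih := ih fun c' hc' => hne c' (List.mem_append_left _ hc')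
    have hc : c.1 ≠ c.2 := hne c (by simp)
    have hsub : runCalls n cs ⊆ runCalls n (cs ++ [c]) :=
      runCalls_subset_of_sublist (List.sublist_append_left _ _)
    have hmono : knowers (runCalls n cs) f ⊆ knowers (runCalls n (cs ++ [c])) f :=
      fun b hb => hsub hb
    by_cases hold : a :: f ∈ runCalls n cs
    · obtain ⟨xs, hxs, hmem, hlen⟩ := ih a f hf hold
      exact ⟨xs, hxs.trans (List.sublist_append_left _ _), hmem,
        hlen.trans (Nat.add_le_add_left (Set.ncard_le_ncard hmono) _)⟩
    have h' := h
    rw [runCalls_concat] at h'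
    obtain h' | ⟨w, g, hwg, hw, hwc, hg, hS⟩ := h'
    · exact absurd h' hold
    obtain ⟨b, hb, hbg⟩ : ∃ b, (b = c.1 ∨ b = c.2) ∧ b :: g ∈ runCalls n cs := by
      rcases hS with hS | hS
      · exact ⟨_, Or.inl rfl, hS⟩
      · exact ⟨_, Or.inr rfl, hS⟩
    obtain ⟨xs, hxs, hmem, hlen⟩ := ih b g hg hbg
    refine ⟨xs ++ [c], hxs.append (List.Sublist.refl _), ?_, ?_⟩
    · rw [runCalls_concat]
      refine Or.inr ⟨w, g, hwg, hw, hwc, hg, ?_⟩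
      rcases hb with rfl | rfl
      · exact Or.inl hmem
      · exact Or.inr hmem
    obtain ⟨a', v, rfl⟩ := List.exists_cons_of_ne_nil hw
    obtain ⟨rfl, rfl⟩ : a = a' ∧ f = v ++ g := by simpa using hwg
    rw [List.length_append, List.length_singleton]
    rcases v with _ | ⟨e, v⟩
    · have hlt : (knowers (runCalls n cs) g).ncard < (knowers (runCalls n (cs ++ [c])) g).ncard :=
        Set.ncard_lt_ncard ((Set.ssubset_iff_of_subset hmono).2 ⟨a, h, hold⟩)
      simp only [List.nil_append] at *
      omega
    · have hpair : {c.1, c.2} ⊆ knowers (runCalls n (cs ++ [c])) (e :: v ++ g) := by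
        intro x hx
        change x :: (e :: v ++ g) ∈ runCalls n (cs ++ [c])
        rw [runCalls_concat]
        refine Or.inr ⟨x :: e :: v, g, rfl, by simp, ?_, hg, hS⟩
        intro y hy
        rcases List.mem_cons.1 hy with rfl | hy
        · simpa using hx
        · exact hwc y (List.mem_cons_of_mem _ hy)
      have htwo := Set.ncard_le_ncard hpair
      rw [Set.ncard_pair hc] at htwo
      have hle := ncard_knowers_le (runCalls n cs) g
      have hmul : (g.length + 1) * (n - 1) ≤ (e :: v ++ g).length * (n - 1) :=
        Nat.mul_le_mul_right _ (by simp)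
      rw [Nat.add_mul, Nat.one_mul] at hmul
      have := a.pos
      omega

/-- Every true fluent of length at most `d + 1` is already made true by `d * (n - 1)` of the
calls. -/
theorem exists_sublist_mem_runCalls {n d : ℕ} (calls : List (Fin n × Fin n))
    (hne : ∀ c ∈ calls, c.1 ≠ c.2) (l : List (Fin n)) (hl : l ≠ []) (hd : l.length ≤ d + 1)
    (h : l ∈ runCalls n calls) :
    ∃ xs, xs.Sublist calls ∧ l ∈ runCalls n xs ∧ xs.length ≤ d * (n - 1) := by
  obtain ⟨a, f, rfl⟩ := List.exists_cons_of_ne_nil hl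
  by_cases hf : f = []
  · subst hf
    exact ⟨[], List.nil_sublist _, Or.inl ⟨a, rfl⟩, by simp⟩
  · obtain ⟨xs, hxs, hmem, hlen⟩ := exists_sublist_mem_runCalls_of_knowers calls hne a f hf h
    refine ⟨xs, hxs, hmem, ?_⟩
    have hle := ncard_knowers_le (runCalls n calls) f
    have hmul : f.length * (n - 1) ≤ d * (n - 1) :=
      Nat.mul_le_mul_right _ (by simpa using hd)
    have := a.pos
    omega

/-- Finitely many true fluents of length at most `d + 1` are already made true by `d * (n - 1)` of
the calls per fluent. -/
theorem exists_sublist_forall_mem_runCalls {n d : ℕ} (calls : List (Fin n × Fin n))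
    (hne : ∀ c ∈ calls, c.1 ≠ c.2) (P : Finset (List (Fin n)))
    (hP : ∀ l ∈ P, l ≠ [] ∧ l.length ≤ d + 1) (h : ∀ l ∈ P, l ∈ runCalls n calls) :
    ∃ xs, xs.Sublist calls ∧ (∀ l ∈ P, l ∈ runCalls n xs) ∧
      xs.length ≤ P.card * (d * (n - 1)) := by
  classical
  induction P using Finset.induction_on with
  | empty => exact ⟨[], List.nil_sublist _, by simp, by simp⟩
  | insert l P hlP ih =>
    rw [Finset.forall_mem_insert] at hP h
    obtain ⟨xs, hxs, hxmem, hxlen⟩ := ih hP.2 h.2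
    obtain ⟨ys, hys, hymem, hylen⟩ := exists_sublist_mem_runCalls calls hne l hP.1.1 hP.1.2 h.1
    obtain ⟨zs, hzs, hxz, hyz, hzlen⟩ := hxs.exists_common_superlist hys
    refine ⟨zs, hzs, ?_, ?_⟩
    · rw [Finset.forall_mem_insert]
      exact ⟨runCalls_subset_of_sublist hyz hymem,
        fun k hk => runCalls_subset_of_sublist hxz (hxmem k hk)⟩
    · rw [Finset.card_insert_of_notMem hlP, Nat.add_mul, Nat.one_mul]
      omega

theorem gossip_neg_short_plan (n : ℕ) (hn : 2 ≤ n) (G : SimpleGraph (Fin n)) (d : ℕ)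
    (Pos Neg : Finset (List (Fin n)))
    (hPos : ∀ l ∈ Pos, l ≠ [] ∧ l.length ≤ d + 1)
    (hNeg : ∀ l ∈ Neg, l ≠ [] ∧ l.length ≤ d + 1)
    (hsol : ∃ calls : List (Fin n × Fin n), (∀ c ∈ calls, G.Adj c.1 c.2) ∧
      (∀ l ∈ Pos, l ∈ runCalls n calls) ∧ ∀ l ∈ Neg, l ∉ runCalls n calls) :
    ∃ calls : List (Fin n × Fin n), (∀ c ∈ calls, G.Adj c.1 c.2) ∧
      calls.length ≤ (Pos.card + Neg.card) * d * (n - 1) ∧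
      (∀ l ∈ Pos, l ∈ runCalls n calls) ∧ ∀ l ∈ Neg, l ∉ runCalls n calls := by
  obtain ⟨calls, hadj, hpos, hneg⟩ := hsol
  obtain ⟨xs, hxs, hmem, hlen⟩ := exists_sublist_forall_mem_runCalls calls
    (fun c hc => (hadj c hc).ne) Pos hPos hpos
  refine ⟨xs, fun c hc => hadj c (hxs.subset hc), ?_, hmem,
    fun l hl hx => hneg l hl (runCalls_subset_of_sublist hxs hx)⟩
  rw [Nat.mul_assoc]
  exact hlen.trans (Nat.mul_le_mul_right _ (Nat.le_add_right _ _))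
end

section
/- With n = 2 agents, labelled 1 and 2, and the complete graph on them, no call sequence leads to a state in which the fluent (1,2) is true and the fluent (2,1) is false; i.e., the goals K_1 s_2 and ¬K_2 s_1 cannot be simultaneously achieved by calls alone. -/
theorem subset_foldl_callStep {n : ℕ} (calls : List (Fin n × Fin n)) (S : Set (List (Fin n))) :
    S ⊆ calls.foldl (fun S c => callStep c.1 c.2 S) S := by
  induction calls generalizing S with
  | nil => exact subset_rfl
  | cons c cs ih => exact Set.subset_union_left.trans (ih (callStep c.1 c.2 S))

/-- After a call between `i` and `j`, each of the two knows the other's secret. -/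
theorem pair_mem_callStep_initState {n : ℕ} {i j a b : Fin n} (ha : a = i ∨ a = j)
    (hb : b = i ∨ b = j) : [a, b] ∈ callStep i j (initState n) := by
  refine Or.inr ⟨[a], [b], rfl, by simp, by simpa using ha, by simp, ?_⟩
  rcases hb with rfl | rfl
  · exact Or.inl (Or.inr ⟨[], b, rfl⟩)
  · exact Or.inr (Or.inr ⟨[], b, rfl⟩)

theorem pair_mem_initState_iff {n : ℕ} {a b : Fin n} : [a, b] ∈ initState n ↔ a = b := by
  constructor
  · rintro (⟨j, h⟩ | ⟨p, j, h⟩)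
    · simp at h
    · have hp : p = [] := by
        have hl := congrArg List.length h
        simp only [List.length_cons, List.length_nil, List.length_append] at hl
        exact List.length_eq_zero_iff.mp (by omega)
      subst hp
      simp only [List.nil_append, List.cons.injEq, and_true] at h
      exact h.1.trans h.2.symm
  · rintro rfl
    exact Or.inr ⟨[], a, rfl⟩

theorem no_asymmetric_knowledge_by_calls :
    ¬ ∃ calls : List (Fin 2 × Fin 2), (∀ c ∈ calls, c.1 ≠ c.2) ∧
      [(0 : Fin 2), 1] ∈ runCalls 2 calls ∧ [(1 : Fin 2), 0] ∉ runCalls 2 calls := by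
  rintro ⟨calls, hne, h01, h10⟩
  cases calls with
  | nil => exact zero_ne_one (pair_mem_initState_iff.mp h01)
  | cons c cs =>
    have hc : c.1 ≠ c.2 := hne c List.mem_cons_self
    refine h10 (subset_foldl_callStep cs _ (pair_mem_callStep_initState ?_ ?_)) <;> omega
end

section
/- Fix an agent j. If an epistemic state S is transformed into S' by one parallel step (a matching of calls), then the number of agents a with (a, j) ∈ S' is at most twice the number of agents a with (a, j) ∈ S; i.e., each parallel step at most doubles the number of agents who know the secret s_j. -/
/-- In a matching, an agent has at most one partner. -/
theorem IsMatching.partner_unique {n : ℕ} {M : List (Fin n × Fin n)} (hM : IsMatching M)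
    {a a' b : Fin n} (h : (a, b) ∈ M ∨ (b, a) ∈ M) (h' : (a', b) ∈ M ∨ (b, a') ∈ M) :
    a = a' := by
  have key : ∀ c ∈ M, ∀ c' ∈ M, c ≠ c' →
      c.1 ≠ c'.1 ∧ c.1 ≠ c'.2 ∧ c.2 ≠ c'.1 ∧ c.2 ≠ c'.2 := by
    have hsymm : Std.Symm fun c c' : Fin n × Fin n =>
        c.1 ≠ c'.1 ∧ c.1 ≠ c'.2 ∧ c.2 ≠ c'.1 ∧ c.2 ≠ c'.2 :=
      ⟨fun _ _ h => ⟨h.1.symm, h.2.2.1.symm, h.2.1.symm, h.2.2.2.symm⟩⟩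
    exact fun c hc c' hc' hne => hM.2.forall hc hc' hne
  by_contra hne
  rcases h with h | h <;> rcases h' with h' | h' <;>
    have hd := key _ h _ h' <;> have h₁ := hM.1 _ h <;> simp_all

/-- An agent knowing `s_j` after a parallel step knew it before, or has a partner who did. -/
theorem mem_or_exists_partner_of_mem_parStep {n : ℕ} {M : List (Fin n × Fin n)}
    {S : Set (List (Fin n))} {a j : Fin n} (h : [a, j] ∈ parStep M S) :
    [a, j] ∈ S ∨ ∃ b, [b, j] ∈ S ∧ ((a, b) ∈ M ∨ (b, a) ∈ M) := by
  rcases h with h | ⟨⟨x, y⟩, hc, w, f, hl, hw, hmem, hf, hS⟩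
  · exact Or.inl h
  obtain ⟨u, w, rfl⟩ := List.exists_cons_of_ne_nil hw
  obtain ⟨v, f, rfl⟩ := List.exists_cons_of_ne_nil hf
  obtain ⟨rfl, rfl, rfl, rfl⟩ : a = u ∧ w = [] ∧ j = v ∧ f = [] := by
    cases w <;> simp_all
  rcases hmem a (by simp) with rfl | rfl <;> rcases hS with hS | hS
  · exact Or.inl hS
  · exact Or.inr ⟨y, hS, Or.inl hc⟩
  · exact Or.inr ⟨x, hS, Or.inr hc⟩
  · exact Or.inl hS

theorem parallel_step_at_most_doubles (n : ℕ) (hn : 2 ≤ n) (j : Fin n)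
    (M : List (Fin n × Fin n)) (hM : IsMatching M) (S : Set (List (Fin n))) :
    {a : Fin n | [a, j] ∈ parStep M S}.ncard ≤ 2 * {a : Fin n | [a, j] ∈ S}.ncard := by
  set A : Set (Fin n) := {a | [a, j] ∈ S}
  set B : Set (Fin n) := {a | ∃ b, b ∈ A ∧ ((a, b) ∈ M ∨ (b, a) ∈ M)}
  have hB : B.ncard ≤ A.ncard := by
    have hex : ∀ a, ∃ b, a ∈ B → b ∈ A ∧ ((a, b) ∈ M ∨ (b, a) ∈ M) := fun a => by
      by_cases ha : a ∈ B
      · obtain ⟨b, hb⟩ := ha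
        exact ⟨b, fun _ => hb⟩
      · exact ⟨a, fun h => absurd h ha⟩
    choose g hg using hex
    refine Set.ncard_le_ncard_of_injOn g (fun a ha => (hg a ha).1) ?_ A.toFinite
    intro a ha a' ha' heq
    have h' := (hg a' ha').2
    rw [← heq] at h'
    exact hM.partner_unique (hg a ha).2 h'
  calc {a : Fin n | [a, j] ∈ parStep M S}.ncard
      ≤ (A ∪ B).ncard :=
        Set.ncard_le_ncard (fun _ ha => mem_or_exists_partner_of_mem_parStep ha) (Set.toFinite _)
    _ ≤ A.ncard + B.ncard := Set.ncard_union_le A B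
    _ ≤ 2 * A.ncard := by omega
end
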